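/- arXiv:2304.11757 — 2 statements merged into one kernel-verified Lean document; each statement's English description precedes it below -/
import Mathlib

section
/- Let P₀ ⊆ ℝⁿ be nonempty and bounded, let W ⊆ ℝⁿ be compact and convex, let Ω ⊆ ℝⁿ be arbitrary, and set T = Ω ∩ (P₀ ⊕ W). Then the following are equivalent: (1) there exists w ∈ W such that P₀ ⊕ {w} ⊆ Ω; (2) the set {r ∈ ℝⁿ : P₀ ⊕ {r} ⊆ conv(T)} \ {r ∈ ℝⁿ : (P₀ ⊕ {r}) ∩ (conv(T) \ T) ≠ ∅} is nonempty, i.e., 𝓘(P₀, conv(T)) \ 𝓞(P₀, conv(T) \ T) ≠ ∅. -/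
open Pointwise

/-- Cancellation for Minkowski sums: a translation carrying a nonempty bounded set `P` into `P + W`,
with `W` closed and convex, belongs to `W`. -/
theorem mem_of_add_singleton_subset_add {E : Type*} [NormedAddCommGroup E] [NormedSpace ℝ E]
    {P W : Set E} (hP : P.Nonempty) (hPb : Bornology.IsBounded P) (hW : IsClosed W)
    (hWc : Convex ℝ W) {r : E} (h : P + {r} ⊆ P + W) : r ∈ W := by
  by_contra hr
  obtain ⟨f, u, hfW, hfr⟩ := geometric_hahn_banach_closed_point hWc hW hr
  have hbdd : BddAbove (f '' P) := (f.lipschitz.isBounded_image hPb).bddAbove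
  obtain ⟨_, ⟨p, hp, rfl⟩, hlt⟩ :=
    exists_lt_of_lt_csSup (hP.image f) (sub_lt_self (sSup (f '' P)) (sub_pos.2 hfr))
  obtain ⟨q, hq, w, hw, hqw⟩ := h (Set.add_mem_add hp (Set.mem_singleton r))
  have hfeq : f q + f w = f p + f r := by
    rw [← map_add, ← map_add]
    exact congrArg f hqw
  linarith [le_csSup hbdd (Set.mem_image_of_mem f hq), hfW w hw]

/-- Lemma 4 (feasibility via polytope translation): with `T = Ω ∩ (P₀ ⊕ W)`,
there exists `w ∈ W` with `P₀ ⊕ {w} ⊆ Ω` iff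
`𝓘(P₀, conv T) \ 𝓞(P₀, conv T \ T)` is nonempty. -/
theorem feasibility_iff_insertion_minus_overlap
    (n : ℕ) (P₀ W Ω : Set (Fin n → ℝ))
    (hP : P₀.Nonempty) (hPb : Bornology.IsBounded P₀)
    (hW : IsCompact W) (hWc : Convex ℝ W)
    (T : Set (Fin n → ℝ)) (hT : T = Ω ∩ (P₀ + W)) :
    (∃ w ∈ W, P₀ + ({w} : Set (Fin n → ℝ)) ⊆ Ω) ↔
      ({r : Fin n → ℝ | P₀ + ({r} : Set (Fin n → ℝ)) ⊆ convexHull ℝ T} \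
        {r : Fin n → ℝ |
          ((P₀ + ({r} : Set (Fin n → ℝ))) ∩ (convexHull ℝ T \ T)).Nonempty}).Nonempty := by
  constructor
  · rintro ⟨w, hw, hwΩ⟩
    have hwT : P₀ + {w} ⊆ T := hT ▸
      Set.subset_inter hwΩ (Set.add_subset_add_left (Set.singleton_subset_iff.2 hw))
    exact ⟨w, hwT.trans (subset_convexHull ℝ T), fun ⟨_, hx, hx'⟩ => hx'.2 (hwT hx)⟩
  · rintro ⟨r, hr, hr'⟩
    have hrT : P₀ + {r} ⊆ Ω ∩ (P₀ + W) := hT ▸ fun x hx =>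
      by_contra fun hxT => hr' ⟨x, hx, hr hx, hxT⟩
    exact ⟨r, mem_of_add_singleton_subset_add hP hPb hW.isClosed hWc
      (hrT.trans Set.inter_subset_right), hrT.trans Set.inter_subset_left⟩
end

section
/- Let f : ℝⁿ × ℝᵐ → ℝⁿ be continuous, let 𝒰 ⊆ ℝᵐ be compact, and let Ω₁,…,Ω_N ⊆ ℝⁿ be closed sets with Ω = ⋃_{i=1}^N Ω_i. For k ≥ 0, let (I_{1:N})^k(Ω) denote the union of the collection obtained from (Ω₁,…,Ω_N) after k full sweeps (each sweep replaces, in order for i = 1,…,N, the i-th component by Q(current union) ∩ (current i-th component), where Q(S) = {x : ∃ u ∈ 𝒰, f(x, u) ∈ S}), and let I^k(Ω) be the k-th iterate of I(S) = Q(S) ∩ S starting from Ω. Then ⋂_{k ≥ 0} (I_{1:N})^k(Ω) = ⋂_{k ≥ 0} I^k(Ω) = I^∞(Ω), the maximal controlled invariant subset of Ω. -/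
/-- The pre-set (one-step backward reachable set) operator. -/
def preSet {n m : ℕ} (f : (Fin n → ℝ) × (Fin m → ℝ) → (Fin n → ℝ))
    (𝒰 : Set (Fin m → ℝ)) (S : Set (Fin n → ℝ)) : Set (Fin n → ℝ) :=
  {x | ∃ u ∈ 𝒰, f (x, u) ∈ S}

/-- The operator `I_i`: replace the `i`-th component of the collection `C` by
`Q(⋃ⱼ Cⱼ) ∩ Cᵢ`, leaving the other components unchanged. -/
def stepAt {n m N : ℕ} (f : (Fin n → ℝ) × (Fin m → ℝ) → (Fin n → ℝ))
    (𝒰 : Set (Fin m → ℝ)) (C : Fin N → Set (Fin n → ℝ)) (i : Fin N) :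
    Fin N → Set (Fin n → ℝ) :=
  Function.update C i (preSet f 𝒰 (⋃ j, C j) ∩ C i)

/-- One full sweep `I_{1:N}`: apply `I_1, I_2, …, I_N` in order. -/
def sweep {n m N : ℕ} (f : (Fin n → ℝ) × (Fin m → ℝ) → (Fin n → ℝ))
    (𝒰 : Set (Fin m → ℝ)) (C : Fin N → Set (Fin n → ℝ)) :
    Fin N → Set (Fin n → ℝ) :=
  (List.finRange N).foldl (stepAt f 𝒰) C

theorem preSet_mono {n m : ℕ} (f : (Fin n → ℝ) × (Fin m → ℝ) → (Fin n → ℝ))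
    (𝒰 : Set (Fin m → ℝ)) {S T : Set (Fin n → ℝ)} (h : S ⊆ T) :
    preSet f 𝒰 S ⊆ preSet f 𝒰 T :=
  fun _ ⟨u, hu, hx⟩ => ⟨u, hu, h hx⟩

theorem isClosed_preSet {n m : ℕ} {f : (Fin n → ℝ) × (Fin m → ℝ) → (Fin n → ℝ)}
    (hf : Continuous f) {𝒰 : Set (Fin m → ℝ)} (h𝒰 : IsCompact 𝒰) {S : Set (Fin n → ℝ)}
    (hS : IsClosed S) : IsClosed (preSet f 𝒰 S) := by
  have : CompactSpace 𝒰 := isCompact_iff_compactSpace.mp h𝒰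
  have hg : Continuous fun p : (Fin n → ℝ) × 𝒰 => f (p.1, p.2) := by fun_prop
  convert isClosedMap_fst_of_compactSpace _ (hS.preimage hg) using 1
  ext x
  simp [preSet]

/-- The intersection of a decreasing sequence of closed sets, each contained in the pre-set of
the previous one, is controlled invariant. -/
theorem iInter_subset_preSet_iInter {n m : ℕ}
    {f : (Fin n → ℝ) × (Fin m → ℝ) → (Fin n → ℝ)} (hf : Continuous f)
    {𝒰 : Set (Fin m → ℝ)} (h𝒰 : IsCompact 𝒰) {A : ℕ → Set (Fin n → ℝ)}
    (hA : ∀ k, IsClosed (A k)) (hanti : ∀ k, A (k + 1) ⊆ A k)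
    (hpre : ∀ k, A (k + 1) ⊆ preSet f 𝒰 (A k)) :
    ⋂ k, A k ⊆ preSet f 𝒰 (⋂ k, A k) := by
  intro x hx
  have hclosed : ∀ k, IsClosed {u | f (x, u) ∈ A k} := fun k =>
    (hA k).preimage (by fun_prop : Continuous fun u => f (x, u))
  obtain ⟨u, hu⟩ := IsCompact.nonempty_iInter_of_sequence_nonempty_isCompact_isClosed
    (fun k => 𝒰 ∩ {u | f (x, u) ∈ A k})
    (fun k u hu => ⟨hu.1, hanti k hu.2⟩)
    (fun k => hpre k (Set.mem_iInter.mp hx (k + 1)))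
    (h𝒰.inter_right (hclosed 0))
    (fun k => h𝒰.isClosed.inter (hclosed k))
  rw [Set.mem_iInter] at hu
  exact ⟨u, (hu 0).1, Set.mem_iInter.mpr fun k => (hu k).2⟩

theorem stepAt_subset {n m N : ℕ} (f : (Fin n → ℝ) × (Fin m → ℝ) → (Fin n → ℝ))
    (𝒰 : Set (Fin m → ℝ)) (C : Fin N → Set (Fin n → ℝ)) (i j : Fin N) :
    stepAt f 𝒰 C i j ⊆ C j := by
  rcases eq_or_ne j i with rfl | h
  · simp [stepAt]
  · simp [stepAt, h]

theorem foldl_stepAt_subset {n m N : ℕ} (f : (Fin n → ℝ) × (Fin m → ℝ) → (Fin n → ℝ))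
    (𝒰 : Set (Fin m → ℝ)) (l : List (Fin N)) (C : Fin N → Set (Fin n → ℝ)) (j : Fin N) :
    l.foldl (stepAt f 𝒰) C j ⊆ C j := by
  induction l generalizing C with
  | nil => rfl
  | cons i l ih => exact (ih _).trans (stepAt_subset f 𝒰 C i j)

theorem foldl_stepAt_subset_preSet {n m N : ℕ}
    (f : (Fin n → ℝ) × (Fin m → ℝ) → (Fin n → ℝ)) (𝒰 : Set (Fin m → ℝ))
    (l : List (Fin N)) (C : Fin N → Set (Fin n → ℝ)) {j : Fin N} (hj : j ∈ l) :
    l.foldl (stepAt f 𝒰) C j ⊆ preSet f 𝒰 (⋃ i, C i) := by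
  induction l generalizing C with
  | nil => simp at hj
  | cons i l ih =>
    rcases List.mem_cons.mp hj with rfl | h
    · refine (foldl_stepAt_subset f 𝒰 l _ _).trans ?_
      simp [stepAt]
    · exact (ih _ h).trans (preSet_mono f 𝒰 (Set.iUnion_mono (stepAt_subset f 𝒰 C i)))

theorem iUnion_sweep_subset {n m N : ℕ} (f : (Fin n → ℝ) × (Fin m → ℝ) → (Fin n → ℝ))
    (𝒰 : Set (Fin m → ℝ)) (C : Fin N → Set (Fin n → ℝ)) :
    ⋃ j, sweep f 𝒰 C j ⊆ preSet f 𝒰 (⋃ j, C j) ∩ ⋃ j, C j :=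
  Set.iUnion_subset fun j => Set.subset_inter
    (foldl_stepAt_subset_preSet f 𝒰 _ C (List.mem_finRange j))
    ((foldl_stepAt_subset f 𝒰 _ C j).trans (Set.subset_iUnion C j))

/-- A controlled invariant set covered by a collection stays covered after one step. -/
theorem subset_iUnion_stepAt {n m N : ℕ} {f : (Fin n → ℝ) × (Fin m → ℝ) → (Fin n → ℝ)}
    {𝒰 : Set (Fin m → ℝ)} {S : Set (Fin n → ℝ)} (hS : S ⊆ preSet f 𝒰 S)
    {C : Fin N → Set (Fin n → ℝ)} (h : S ⊆ ⋃ j, C j) (i : Fin N) :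
    S ⊆ ⋃ j, stepAt f 𝒰 C i j := by
  intro x hx
  obtain ⟨j, hj⟩ := Set.mem_iUnion.mp (h hx)
  refine Set.mem_iUnion.mpr ⟨j, ?_⟩
  rcases eq_or_ne j i with rfl | hji
  · simpa only [stepAt, Function.update_self] using ⟨preSet_mono f 𝒰 h (hS hx), hj⟩
  · simpa only [stepAt, Function.update_of_ne hji] using hj

theorem subset_iUnion_sweep {n m N : ℕ} {f : (Fin n → ℝ) × (Fin m → ℝ) → (Fin n → ℝ)}
    {𝒰 : Set (Fin m → ℝ)} {S : Set (Fin n → ℝ)} (hS : S ⊆ preSet f 𝒰 S)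
    {C : Fin N → Set (Fin n → ℝ)} (h : S ⊆ ⋃ j, C j) :
    S ⊆ ⋃ j, sweep f 𝒰 C j := by
  unfold sweep
  induction List.finRange N generalizing C with
  | nil => exact h
  | cons i l ih => exact ih (subset_iUnion_stepAt hS h i)

/- Theorem 2 (convergence of the accelerated sweep): for continuous dynamics,
compact input set, and closed pieces `Ωᵢ`, the limit of the sweep iteration
coincides with `I^∞(Ω) = ⋂ₖ I^k(Ω)`, which is the maximal controlled invariant
subset of `Ω`. -/
theorem sweep_limit_eq_maximal_controlled_invariant
    (n m N : ℕ) (f : (Fin n → ℝ) × (Fin m → ℝ) → (Fin n → ℝ))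
    (hf : Continuous f)
    (𝒰 : Set (Fin m → ℝ)) (h𝒰 : IsCompact 𝒰)
    (Ω : Fin N → Set (Fin n → ℝ)) (hΩ : ∀ i, IsClosed (Ω i))
    (Iinf : Set (Fin n → ℝ))
    (hIinf : Iinf = ⋂ k : ℕ, (fun S => preSet f 𝒰 S ∩ S)^[k] (⋃ j, Ω j)) :
    (⋂ k : ℕ, ⋃ j, (sweep f 𝒰)^[k] Ω j) = Iinf ∧
    (∀ x ∈ Iinf, ∃ u ∈ 𝒰, f (x, u) ∈ Iinf) ∧
    (∀ S : Set (Fin n → ℝ), S ⊆ (⋃ j, Ω j) →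
      (∀ x ∈ S, ∃ u ∈ 𝒰, f (x, u) ∈ S) → S ⊆ Iinf) := by
  subst hIinf
  have hsucc : ∀ k, (fun S => preSet f 𝒰 S ∩ S)^[k + 1] (⋃ j, Ω j) =
      preSet f 𝒰 ((fun S => preSet f 𝒰 S ∩ S)^[k] (⋃ j, Ω j)) ∩
        (fun S => preSet f 𝒰 S ∩ S)^[k] (⋃ j, Ω j) :=
    fun k => Function.iterate_succ_apply' _ k _
  have hclosed : ∀ k, IsClosed ((fun S => preSet f 𝒰 S ∩ S)^[k] (⋃ j, Ω j)) := by
    intro k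
    induction k with
    | zero => exact isClosed_iUnion_of_finite hΩ
    | succ k ih => rw [hsucc]; exact (isClosed_preSet hf h𝒰 ih).inter ih
  have hinv := iInter_subset_preSet_iInter hf h𝒰 hclosed
    (fun k => (hsucc k).trans_subset Set.inter_subset_right)
    (fun k => (hsucc k).trans_subset Set.inter_subset_left)
  refine ⟨Set.Subset.antisymm (Set.iInter_mono fun k => ?_) (Set.subset_iInter fun k => ?_),
    hinv, fun S hSΩ hS => Set.subset_iInter fun k => ?_⟩
  · induction k with
    | zero => rfl
    | succ k ih =>
      rw [hsucc, Function.iterate_succ_apply']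
      exact (iUnion_sweep_subset f 𝒰 _).trans (Set.inter_subset_inter (preSet_mono f 𝒰 ih) ih)
  · induction k with
    | zero => exact Set.iInter_subset _ 0
    | succ k ih =>
      rw [Function.iterate_succ_apply']
      exact subset_iUnion_sweep hinv ih
  · induction k with
    | zero => exact hSΩ
    | succ k ih =>
      rw [hsucc]
      exact Set.subset_inter (fun x hx => preSet_mono f 𝒰 ih (hS x hx)) ih
end
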